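/- Let (M,L) be a linear space and X ⊆ M. Define the stages of the R-closure by X_0 = X and X_{n+1} = X_n ∪ {c ∈ M : c ∈ ℓ for some line ℓ ∈ L with |ℓ ∩ X_n| ≥ 2}, and cl_R(X) = ∪_n X_n. If X is finite, then δ(X_n) ≤ δ(X) for every n such that X_n is finite; in particular, if cl_R(X) is finite then δ(cl_R(X)) ≤ δ(X). -/

import Mathlib

open scoped Classical

/-- A linear space: a set of points with a family of lines, each line having at
least 3 points, such that two distinct points lie on at most one line. -/
structure LinearSpace (M : Type*) where
  lines : Set (Set M)
  three_le : ∀ ℓ ∈ lines, ∃ x y z : M,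
    x ∈ ℓ ∧ y ∈ ℓ ∧ z ∈ ℓ ∧ x ≠ y ∧ x ≠ z ∧ y ≠ z
  unique_line : ∀ ⦃x y : M⦄, x ≠ y → ∀ ⦃ℓ₁ : Set M⦄, ℓ₁ ∈ lines →
    ∀ ⦃ℓ₂ : Set M⦄, ℓ₂ ∈ lines →
    x ∈ ℓ₁ → y ∈ ℓ₁ → x ∈ ℓ₂ → y ∈ ℓ₂ → ℓ₁ = ℓ₂

variable {M : Type*}

/-- The lines meeting a finite set `S` in at least two points. -/
def lineContrib (LS : LinearSpace M) (S : Finset M) : Set (Set M) :=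
  {ℓ | ℓ ∈ LS.lines ∧ 2 ≤ (S.filter (· ∈ ℓ)).card}

lemma lineContrib_finite (LS : LinearSpace M) (S : Finset M) :
    (lineContrib LS S).Finite := by
  have hinj : Set.InjOn (fun ℓ => S.filter (· ∈ ℓ)) (lineContrib LS S) := by
    rintro ℓ₁ ⟨h1, h1c⟩ ℓ₂ ⟨h2, h2c⟩ heq
    simp only at heq
    obtain ⟨x, hx, y, hy, hxy⟩ :=
      Finset.one_lt_card.mp (lt_of_lt_of_le one_lt_two h1c)
    have hx1 := Finset.mem_filter.mp hx
    have hy1 := Finset.mem_filter.mp hy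
    have hx2 := Finset.mem_filter.mp (heq ▸ hx)
    have hy2 := Finset.mem_filter.mp (heq ▸ hy)
    exact LS.unique_line hxy h1 h2 hx1.2 hy1.2 hx2.2 hy2.2
  have himg : (fun ℓ => S.filter (· ∈ ℓ)) '' lineContrib LS S ⊆ ↑S.powerset := by
    rintro t ⟨ℓ, -, rfl⟩
    exact Finset.mem_coe.mpr (Finset.mem_powerset.mpr (Finset.filter_subset _ S))
  exact Set.Finite.of_finite_image
    (Set.Finite.subset S.powerset.finite_toSet himg) hinj

/-- The predimension `δ(S) = |S| - Σ_ℓ max(|ℓ ∩ S| - 2, 0)` of a finite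
subset of a linear space. -/
noncomputable def delta (LS : LinearSpace M) (S : Finset M) : ℤ :=
  (S.card : ℤ) -
    ∑ ℓ ∈ (lineContrib_finite LS S).toFinset, ((S.filter (· ∈ ℓ)).card - 2 : ℤ)

/-- The stages of the `R`-closure of a set `X` in a linear space: at each
stage we add every point lying on a line that already meets the current
stage in at least two points. -/
def Rstage (LS : LinearSpace M) (X : Set M) : ℕ → Set M
  | 0 => X
  | n + 1 => Rstage LS X n ∪
      {c | ∃ ℓ ∈ LS.lines, c ∈ ℓ ∧
        ∃ x ∈ ℓ ∩ Rstage LS X n, ∃ y ∈ ℓ ∩ Rstage LS X n, x ≠ y}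

/-- The `R`-closure of `X`: the union of all the stages. -/
def Rclosure (LS : LinearSpace M) (X : Set M) : Set M :=
  ⋃ n, Rstage LS X n

lemma mem_lineContrib_of_subset {LS : LinearSpace M} {S T : Finset M} (h : S ⊆ T)
    {ℓ : Set M} (hℓ : ℓ ∈ lineContrib LS S) : ℓ ∈ lineContrib LS T :=
  ⟨hℓ.1, hℓ.2.trans (Finset.card_le_card (Finset.filter_subset_filter _ h))⟩

/-- Adding a point of a line that already meets `S` twice does not increase the predimension. -/
lemma delta_insert_le (LS : LinearSpace M) {S : Finset M} {c : M} {ℓ : Set M}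
    (hℓ : ℓ ∈ lineContrib LS S) (hc : c ∈ ℓ) : delta LS (insert c S) ≤ delta LS S := by
  by_cases hcS : c ∈ S
  · rw [Finset.insert_eq_of_mem hcS]
  have hsub : (lineContrib_finite LS S).toFinset ⊆
      (lineContrib_finite LS (insert c S)).toFinset := by
    intro k hk
    rw [Set.Finite.mem_toFinset] at hk ⊢
    exact mem_lineContrib_of_subset (Finset.subset_insert c S) hk
  have hmono : ∀ k : Set M,
      ((S.filter (· ∈ k)).card : ℤ) ≤ ((insert c S).filter (· ∈ k)).card := fun k => by
    exact_mod_cast Finset.card_le_card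
      (Finset.filter_subset_filter _ (Finset.subset_insert c S))
  have hlt : ∑ k ∈ (lineContrib_finite LS S).toFinset, ((S.filter (· ∈ k)).card - 2 : ℤ) <
      ∑ k ∈ (lineContrib_finite LS S).toFinset,
        (((insert c S).filter (· ∈ k)).card - 2 : ℤ) := by
    refine Finset.sum_lt_sum (fun k _ => sub_le_sub_right (hmono k) 2)
      ⟨ℓ, (lineContrib_finite LS S).mem_toFinset.mpr hℓ, ?_⟩
    rw [Finset.filter_insert, if_pos hc, Finset.card_insert_of_notMem (by simp [hcS])]
    push_cast
    linarith
  have hle : ∑ k ∈ (lineContrib_finite LS S).toFinset,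
        (((insert c S).filter (· ∈ k)).card - 2 : ℤ) ≤
      ∑ k ∈ (lineContrib_finite LS (insert c S)).toFinset,
        (((insert c S).filter (· ∈ k)).card - 2 : ℤ) := by
    refine Finset.sum_le_sum_of_subset_of_nonneg hsub fun k hk _ => ?_
    have hk2 := ((lineContrib_finite LS (insert c S)).mem_toFinset.mp hk).2
    exact sub_nonneg.mpr (by exact_mod_cast hk2)
  unfold delta
  rw [Finset.card_insert_of_notMem hcS]
  push_cast
  linarith

lemma delta_union_le (LS : LinearSpace M) (S D : Finset M)
    (hD : ∀ c ∈ D, ∃ ℓ ∈ lineContrib LS S, c ∈ ℓ) : delta LS (S ∪ D) ≤ delta LS S := by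
  induction D using Finset.induction_on with
  | empty => simp
  | insert c D _ ih =>
    obtain ⟨ℓ, hℓ, hc⟩ := hD c (Finset.mem_insert_self c D)
    rw [Finset.union_insert]
    exact (delta_insert_le LS (mem_lineContrib_of_subset Finset.subset_union_left hℓ) hc).trans
      (ih fun d hd => hD d (Finset.mem_insert_of_mem hd))

lemma Rstage_mono (LS : LinearSpace M) (X : Set M) : Monotone (Rstage LS X) :=
  monotone_nat_of_le_succ fun _ => Set.subset_union_left

lemma delta_Rstage_succ_le (LS : LinearSpace M) (X : Set M) (n : ℕ)
    (hn : (Rstage LS X n).Finite) (hn' : (Rstage LS X (n + 1)).Finite) :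
    delta LS hn'.toFinset ≤ delta LS hn.toFinset := by
  have hsub : hn.toFinset ⊆ hn'.toFinset :=
    Set.Finite.toFinset_subset_toFinset.mpr (Rstage_mono LS X n.le_succ)
  rw [← Finset.union_sdiff_of_subset hsub]
  refine delta_union_le LS _ _ fun c hc => ?_
  rw [Finset.mem_sdiff, Set.Finite.mem_toFinset, Set.Finite.mem_toFinset] at hc
  obtain ⟨hc | ⟨ℓ, hℓ, hcℓ, x, hx, y, hy, hxy⟩, hcn⟩ := hc
  · exact absurd hc hcn
  · refine ⟨ℓ, ⟨hℓ, Finset.one_lt_card.mpr ⟨x, ?_, y, ?_, hxy⟩⟩, hcℓ⟩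
    · simpa using hx.symm
    · simpa using hy.symm

lemma exists_Rstage_eq_Rclosure (LS : LinearSpace M) (X : Set M)
    (h : (Rclosure LS X).Finite) : ∃ n, Rstage LS X n = Rclosure LS X := by
  obtain ⟨n, hn⟩ := (Rstage_mono LS X).directed_le.exists_mem_subset_of_finset_subset_biUnion
    (s := h.toFinset) (by rw [h.coe_toFinset]; rfl)
  rw [h.coe_toFinset] at hn
  exact ⟨n, (Set.subset_iUnion _ n).antisymm hn⟩

/-- For a finite `X`, each finite stage `X_n` of the `R`-closure
satisfies `δ(X_n) ≤ δ(X)`; in particular if `cl_R(X)` is finite then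
`δ(cl_R(X)) ≤ δ(X)`. -/
theorem delta_Rclosure_le (M : Type*) (LS : LinearSpace M) (X : Finset M) :
    (∀ n : ℕ, ∀ hn : (Rstage LS (↑X) n).Finite,
      delta LS hn.toFinset ≤ delta LS X) ∧
    (∀ h : (Rclosure LS (↑X)).Finite, delta LS h.toFinset ≤ delta LS X) := by
  have hstage : ∀ n : ℕ, ∀ hn : (Rstage LS (↑X) n).Finite,
      delta LS hn.toFinset ≤ delta LS X := by
    intro n
    induction n with
    | zero =>
      intro hn
      exact (congrArg (delta LS) (Finset.finite_toSet_toFinset X)).le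
    | succ n ih =>
      intro hn'
      have hn := hn'.subset (Rstage_mono LS X n.le_succ)
      exact (delta_Rstage_succ_le LS X n hn hn').trans (ih hn)
  refine ⟨hstage, fun h => ?_⟩
  obtain ⟨n, hn⟩ := exists_Rstage_eq_Rclosure LS X h
  have hfin : (Rstage LS X n).Finite := hn ▸ h
  rw [← Set.Finite.toFinset_inj (hs := hfin) (ht := h)] at hn
  exact hn ▸ hstage n hfin
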